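/- In Levine's free quasi-Lie ring, [X, [Y,Y]] = 0 for all homogeneous elements X ∈ L'_a and Y ∈ L'_b. Consequently, for every k ≥ 1 the assignment X ⊗ Y ↦ X ⊗ [Ŷ,Ŷ] (for Y ∈ L_k with lift Ŷ ∈ L'_k) induces a well-defined homomorphism ℤ₂ ⊗ D'_{k−1} → D'_{2k−1}, using the inclusion D'_{k−1} ⊆ L'_1 ⊗ L'_k and the projection L'_k → L_k on the second factor. -/

import Mathlib

open scoped TensorProduct

/-- Rooted binary trees (formal non-associative bracket monomials) with
leaves labeled in `Fin m`.  The degree is the number of leaves, the order is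
the degree minus one. -/
inductive RTree (m : ℕ) : Type
  | leaf : Fin m → RTree m
  | node : RTree m → RTree m → RTree m

namespace RTree

/-- The degree of a rooted tree = its number of leaves. -/
def deg {m : ℕ} : RTree m → ℕ
  | leaf _ => 1
  | node a b => deg a + deg b

end RTree

/-- One-hole contexts for rooted trees. -/
inductive Ctx (m : ℕ) : Type
  | hole : Ctx m
  | nodeL : Ctx m → RTree m → Ctx m
  | nodeR : RTree m → Ctx m → Ctx m

/-- Fill the hole of a context with a rooted tree. -/
def Ctx.fill {m : ℕ} : Ctx m → RTree m → RTree m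
  | .hole, t => t
  | .nodeL c r, t => RTree.node (c.fill t) r
  | .nodeR l c, t => RTree.node l (c.fill t)

/-- Relators presenting the degree `n` part `L'_n` of the free quasi-Lie ring:
generators of the wrong degree are killed, and antisymmetry and Jacobi
relators are imposed at every position (one-hole context). -/
def quasiLieRels (m n : ℕ) : Set (FreeAbelianGroup (RTree m)) :=
  {x | ∃ J : RTree m, J.deg ≠ n ∧ x = FreeAbelianGroup.of J} ∪
  {x | ∃ (c : Ctx m) (A B : RTree m),
      x = FreeAbelianGroup.of (c.fill (RTree.node A B)) +
          FreeAbelianGroup.of (c.fill (RTree.node B A))} ∪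
  {x | ∃ (c : Ctx m) (A B C : RTree m),
      x = FreeAbelianGroup.of (c.fill (RTree.node A (RTree.node B C))) -
          FreeAbelianGroup.of (c.fill (RTree.node (RTree.node A B) C)) -
          FreeAbelianGroup.of (c.fill (RTree.node B (RTree.node A C)))}

/-- `L'_n`, the degree `n` part of Levine's free quasi-Lie ring on `X_1,…,X_m`. -/
abbrev Lp (m n : ℕ) :=
  FreeAbelianGroup (RTree m) ⧸ AddSubgroup.closure (quasiLieRels m n)

/-- The canonical projection onto `L'_n`. -/
abbrev LpMk (m n : ℕ) : FreeAbelianGroup (RTree m) →+ Lp m n :=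
  QuotientAddGroup.mk' _

/-- Relators for the free Lie ring: additionally kill all squares `[J,J]`
(at every position). -/
def lieRels (m n : ℕ) : Set (FreeAbelianGroup (RTree m)) :=
  quasiLieRels m n ∪
  {x | ∃ (c : Ctx m) (J : RTree m), x = FreeAbelianGroup.of (c.fill (RTree.node J J))}

/-- `L_n`, the degree `n` part of the free Lie ring on `X_1,…,X_m` over `ℤ`. -/
abbrev LL (m n : ℕ) :=
  FreeAbelianGroup (RTree m) ⧸ AddSubgroup.closure (lieRels m n)

/-- The canonical projection onto `L_n`. -/
abbrev LLMk (m n : ℕ) : FreeAbelianGroup (RTree m) →+ LL m n :=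
  QuotientAddGroup.mk' _

/-- The canonical projection `L'_n → L_n`. -/
def LpToLL (m n : ℕ) : Lp m n →+ LL m n :=
  QuotientAddGroup.map _ _ (AddMonoidHom.id _)
    (by
      rw [AddSubgroup.comap_id]
      exact AddSubgroup.closure_mono Set.subset_union_left)

/-- Free-level bracketing `t ↦ [X i, t]` with a degree one generator. -/
def brLeafFree (m : ℕ) (i : Fin m) :
    FreeAbelianGroup (RTree m) →+ FreeAbelianGroup (RTree m) :=
  FreeAbelianGroup.lift fun t => FreeAbelianGroup.of (RTree.node (RTree.leaf i) t)

theorem brLeafFree_mem_quasi {m n : ℕ} (i : Fin m) {x : FreeAbelianGroup (RTree m)}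
    (hx : x ∈ quasiLieRels m n) :
    brLeafFree m i x ∈ AddSubgroup.closure (quasiLieRels m (n + 1)) := by
  apply AddSubgroup.subset_closure
  rcases hx with (⟨J, hJ, rfl⟩ | ⟨c, A, B, rfl⟩) | ⟨c, A, B, C, rfl⟩
  · refine Or.inl (Or.inl ⟨RTree.node (RTree.leaf i) J, ?_, ?_⟩)
    · simp only [RTree.deg]; omega
    · simp [brLeafFree]
  · refine Or.inl (Or.inr ⟨Ctx.nodeR (RTree.leaf i) c, A, B, ?_⟩)
    simp [brLeafFree, Ctx.fill]
  · refine Or.inr ⟨Ctx.nodeR (RTree.leaf i) c, A, B, C, ?_⟩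
    simp [brLeafFree, Ctx.fill]

theorem brLeafFree_closure_quasi {m n : ℕ} (i : Fin m) :
    AddSubgroup.closure (quasiLieRels m n) ≤
      (AddSubgroup.closure (quasiLieRels m (n + 1))).comap (brLeafFree m i) :=
  (AddSubgroup.closure_le _).2 fun _x hx =>
    AddSubgroup.mem_comap.2 (brLeafFree_mem_quasi i hx)

/-- Bracketing `[X_i, ·] : L'_n → L'_{n+1}` with a degree one generator. -/
def brLeaf (m n : ℕ) (i : Fin m) : Lp m n →+ Lp m (n + 1) :=
  QuotientAddGroup.map _ _ (brLeafFree m i) (brLeafFree_closure_quasi i)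

theorem brLeafFree_mem_lie {m n : ℕ} (i : Fin m) {x : FreeAbelianGroup (RTree m)}
    (hx : x ∈ lieRels m n) :
    brLeafFree m i x ∈ AddSubgroup.closure (lieRels m (n + 1)) := by
  apply AddSubgroup.subset_closure
  rcases hx with ((⟨J, hJ, rfl⟩ | ⟨c, A, B, rfl⟩) | ⟨c, A, B, C, rfl⟩) | ⟨c, J, rfl⟩
  · refine Or.inl (Or.inl (Or.inl ⟨RTree.node (RTree.leaf i) J, ?_, ?_⟩))
    · simp only [RTree.deg]; omega
    · simp [brLeafFree]
  · exact Or.inl (Or.inl (Or.inr ⟨Ctx.nodeR (RTree.leaf i) c, A, B, by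
      simp [brLeafFree, Ctx.fill]⟩))
  · exact Or.inl (Or.inr ⟨Ctx.nodeR (RTree.leaf i) c, A, B, C, by
      simp [brLeafFree, Ctx.fill]⟩)
  · exact Or.inr ⟨Ctx.nodeR (RTree.leaf i) c, J, by simp [brLeafFree, Ctx.fill]⟩

theorem brLeafFree_closure_lie {m n : ℕ} (i : Fin m) :
    AddSubgroup.closure (lieRels m n) ≤
      (AddSubgroup.closure (lieRels m (n + 1))).comap (brLeafFree m i) :=
  (AddSubgroup.closure_le _).2 fun _x hx =>
    AddSubgroup.mem_comap.2 (brLeafFree_mem_lie i hx)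

/-- Bracketing `[X_i, ·] : L_n → L_{n+1}` with a degree one generator. -/
def brLeafL (m n : ℕ) (i : Fin m) : LL m n →+ LL m (n + 1) :=
  QuotientAddGroup.map _ _ (brLeafFree m i) (brLeafFree_closure_lie i)

/-- The bracket map `L'_1 ⊗ L'_a → L'_{a+1}`, `X_i ⊗ Y ↦ [X_i, Y]`,
where `L'_1 = L_1 ≅ ℤ^m` is realized as `FreeAbelianGroup (Fin m)` with basis `X_i`.
The kernel of `bracketLp m (n+1)` is the group `D'_n`. -/
noncomputable def bracketLp (m a : ℕ) :
    (FreeAbelianGroup (Fin m)) ⊗[ℤ] (Lp m a) →ₗ[ℤ] Lp m (a + 1) :=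
  TensorProduct.lift
    ((FreeAbelianGroup.lift fun i => (brLeaf m a i).toIntLinearMap).toIntLinearMap)

/-- The bracket map `L_1 ⊗ L_a → L_{a+1}`.  The kernel of `bracketLL m (n+1)` is `D_n`. -/
noncomputable def bracketLL (m a : ℕ) :
    (FreeAbelianGroup (Fin m)) ⊗[ℤ] (LL m a) →ₗ[ℤ] LL m (a + 1) :=
  TensorProduct.lift
    ((FreeAbelianGroup.lift fun i => (brLeafL m a i).toIntLinearMap).toIntLinearMap)

/-- `id ⊗ proj : L_1 ⊗ L'_n → L_1 ⊗ L_n`. -/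
noncomputable def projT (m n : ℕ) :
    (FreeAbelianGroup (Fin m)) ⊗[ℤ] (Lp m n) →ₗ[ℤ]
      (FreeAbelianGroup (Fin m)) ⊗[ℤ] (LL m n) :=
  LinearMap.lTensor _ (LpToLL m n).toIntLinearMap

/-- Given a rooted tree `t` and a rooted tree `rest` (representing the rest of the
unrooted tree `⟨t, rest⟩` hanging off the root edge of `t`), list, for each leaf `v`
of `t`, the label of `v` together with the rooted tree obtained from the unrooted
tree `⟨t, rest⟩` by making `v` the root. -/
def rerootList {m : ℕ} : RTree m → RTree m → List (Fin m × RTree m)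
  | RTree.leaf i, rest => [(i, rest)]
  | RTree.node a b, rest =>
      rerootList a (RTree.node b rest) ++ rerootList b (RTree.node rest a)

/-- All univalent vertices of the unrooted tree `⟨p.1, p.2⟩`, together with the
corresponding rerooted trees. -/
def pairReroots {m : ℕ} (p : RTree m × RTree m) : List (Fin m × RTree m) :=
  rerootList p.1 p.2 ++ rerootList p.2 p.1

/-- Relators presenting the order `n` tree group `𝒯_n`.  An unrooted unitrivalent
labeled vertex-oriented tree is presented as the inner product `⟨I,J⟩` of a pair of
rooted trees (cutting an edge); generators of the wrong order are killed, and we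
impose: symmetry `⟨I,J⟩ = ⟨J,I⟩`, edge-sliding `⟨(A,B),C⟩ = ⟨A,(B,C)⟩` (both of
which express that the pair presents the same unrooted tree), antisymmetry (AS),
and Jacobi (IHX) relations. -/
def treeRels (m n : ℕ) : Set (FreeAbelianGroup (RTree m × RTree m)) :=
  {x | ∃ p : RTree m × RTree m, p.1.deg + p.2.deg ≠ n + 2 ∧ x = FreeAbelianGroup.of p} ∪
  {x | ∃ I J : RTree m, x = FreeAbelianGroup.of (I, J) - FreeAbelianGroup.of (J, I)} ∪
  {x | ∃ A B C : RTree m,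
      x = FreeAbelianGroup.of (RTree.node A B, C) - FreeAbelianGroup.of (A, RTree.node B C)} ∪
  {x | ∃ A B C : RTree m,
      x = FreeAbelianGroup.of (RTree.node A B, C) + FreeAbelianGroup.of (RTree.node B A, C)} ∪
  {x | ∃ A B C D : RTree m,
      x = FreeAbelianGroup.of (RTree.node A (RTree.node B C), D)
        - FreeAbelianGroup.of (RTree.node (RTree.node A B) C, D)
        - FreeAbelianGroup.of (RTree.node B (RTree.node A C), D)}

/-- `𝒯_n`, the order `n` tree group. -/
abbrev Tgrp (m n : ℕ) :=
  FreeAbelianGroup (RTree m × RTree m) ⧸ AddSubgroup.closure (treeRels m n)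

/-- The canonical projection onto `𝒯_n`; the generator `⟨I,J⟩` is `TMk m n (.of (I,J))`. -/
abbrev TMk (m n : ℕ) : FreeAbelianGroup (RTree m × RTree m) →+ Tgrp m n :=
  QuotientAddGroup.mk' _

/-- The boundary-twist relators `⟨(i,J),J⟩` (for `J` of order `k-1`, i.e. degree `k`). -/
def btRels (m k : ℕ) : Set (FreeAbelianGroup (RTree m × RTree m)) :=
  {x | ∃ (i : Fin m) (J : RTree m), J.deg = k ∧
      x = FreeAbelianGroup.of (RTree.node (RTree.leaf i) J, J)}

/-- `𝒯^∞_{2k-1}`, the quotient of `𝒯_{2k-1}` by the boundary-twist relations. -/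
abbrev Tinfodd (m k : ℕ) :=
  FreeAbelianGroup (RTree m × RTree m) ⧸
    AddSubgroup.closure (treeRels m (2 * k - 1) ∪ btRels m k)

abbrev TinfoddMk (m k : ℕ) : FreeAbelianGroup (RTree m × RTree m) →+ Tinfodd m k :=
  QuotientAddGroup.mk' _

/-- Relators presenting `𝒯^∞_{2k}`: generators are order `2k` unrooted trees
(`Sum.inl` of a pair of rooted trees, as in `treeRels`) together with `∞`-trees
`J^∞` (`Sum.inr J`) for rooted trees `J` of order `k` (degree `k+1`).  Relations:
the relations of `𝒯_{2k}` among the non-`∞` trees, wrong-degree `∞`-generators are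
killed, the symmetry relations `(-J)^∞ = J^∞`, the twisted IHX relations
`I^∞ = H^∞ + X^∞ - ⟨H,X⟩`, and the interior-twist relations `2 J^∞ = ⟨J,J⟩`. -/
def tinfRels (m k : ℕ) : Set (FreeAbelianGroup ((RTree m × RTree m) ⊕ RTree m)) :=
  (⇑(FreeAbelianGroup.map (Sum.inl : RTree m × RTree m → (RTree m × RTree m) ⊕ RTree m)) ''
      treeRels m (2 * k)) ∪
  {x | ∃ J : RTree m, J.deg ≠ k + 1 ∧ x = FreeAbelianGroup.of (Sum.inr J)} ∪
  {x | ∃ (c : Ctx m) (A B : RTree m),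
      x = FreeAbelianGroup.of (Sum.inr (c.fill (RTree.node A B)))
        - FreeAbelianGroup.of (Sum.inr (c.fill (RTree.node B A)))} ∪
  {x | ∃ (c : Ctx m) (A B C : RTree m),
      x = FreeAbelianGroup.of (Sum.inr (c.fill (RTree.node A (RTree.node B C))))
        - FreeAbelianGroup.of (Sum.inr (c.fill (RTree.node (RTree.node A B) C)))
        - FreeAbelianGroup.of (Sum.inr (c.fill (RTree.node B (RTree.node A C))))
        + FreeAbelianGroup.of (Sum.inl (c.fill (RTree.node (RTree.node A B) C),
            c.fill (RTree.node B (RTree.node A C))))} ∪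
  {x | ∃ J : RTree m,
      x = FreeAbelianGroup.of (Sum.inr J) + FreeAbelianGroup.of (Sum.inr J)
        - FreeAbelianGroup.of (Sum.inl (J, J))}

/-- `𝒯^∞_{2k}`, the twisted tree group in even order `2k`. -/
abbrev Tinf (m k : ℕ) :=
  FreeAbelianGroup ((RTree m × RTree m) ⊕ RTree m) ⧸ AddSubgroup.closure (tinfRels m k)

abbrev TinfMk (m k : ℕ) :
    FreeAbelianGroup ((RTree m × RTree m) ⊕ RTree m) →+ Tinf m k :=
  QuotientAddGroup.mk' _

/-- The degree-guarded free-level bracket: for `s, t` rooted trees,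
`brFree m a b (of s) (of t) = of [s,t]` if `s` has degree `a` and `t` degree `b`,
and `0` otherwise.  It induces the bracket `L'_a × L'_b → L'_{a+b}`. -/
def brFree (m a b : ℕ) :
    FreeAbelianGroup (RTree m) →+
      FreeAbelianGroup (RTree m) →+ FreeAbelianGroup (RTree m) :=
  FreeAbelianGroup.lift fun s =>
    FreeAbelianGroup.lift fun t =>
      if s.deg = a ∧ t.deg = b then FreeAbelianGroup.of (RTree.node s t) else 0

/-- Composition of one-hole contexts, the second argument being the inner one. -/
def Ctx.comp {m : ℕ} : Ctx m → Ctx m → Ctx m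
  | .hole, e => e
  | .nodeL c r, e => .nodeL (c.comp e) r
  | .nodeR l c, e => .nodeR l (c.comp e)

theorem Ctx.fill_comp {m : ℕ} (d e : Ctx m) (t : RTree m) :
    (d.comp e).fill t = d.fill (e.fill t) := by
  induction d with
  | hole => rfl
  | nodeL c r ih => simp [Ctx.comp, Ctx.fill, ih]
  | nodeR l c ih => simp [Ctx.comp, Ctx.fill, ih]

theorem Ctx.deg_fill_congr {m : ℕ} (c : Ctx m) {s t : RTree m} (h : s.deg = t.deg) :
    (c.fill s).deg = (c.fill t).deg := by
  induction c with
  | hole => exact h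
  | nodeL c r ih => simp [Ctx.fill, RTree.deg, ih]
  | nodeR l c ih => simp [Ctx.fill, RTree.deg, ih]

theorem LpMk_eq_zero_iff {m n : ℕ} {x : FreeAbelianGroup (RTree m)} :
    LpMk m n x = 0 ↔ x ∈ AddSubgroup.closure (quasiLieRels m n) :=
  QuotientAddGroup.eq_zero_iff x

theorem LpMk_fill_antisymm {m : ℕ} (n : ℕ) (c : Ctx m) (A B : RTree m) :
    LpMk m n (.of (c.fill (.node A B))) = -LpMk m n (.of (c.fill (.node B A))) := by
  rw [eq_neg_iff_add_eq_zero, ← map_add, LpMk_eq_zero_iff]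
  exact AddSubgroup.subset_closure (Or.inl (Or.inr ⟨c, A, B, rfl⟩))

theorem LpMk_fill_jacobi {m : ℕ} (n : ℕ) (c : Ctx m) (A B C : RTree m) :
    LpMk m n (.of (c.fill (.node A (.node B C)))) =
      LpMk m n (.of (c.fill (.node (.node A B) C))) +
        LpMk m n (.of (c.fill (.node B (.node A C)))) := by
  rw [← sub_eq_zero, ← sub_sub, ← map_sub, ← map_sub, LpMk_eq_zero_iff]
  exact AddSubgroup.subset_closure (Or.inr ⟨c, A, B, C, rfl⟩)

theorem LpMk_fill_node_square {m : ℕ} (n : ℕ) (d : Ctx m) (X J : RTree m) :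
    LpMk m n (.of (d.fill (.node X (.node J J)))) = 0 := by
  rw [LpMk_fill_jacobi, LpMk_fill_antisymm n d (.node X J) J, neg_add_cancel]

/-- A tree containing a square at a position other than the root vanishes in `L'_n`. -/
theorem LpMk_fill_node_fill_square {m : ℕ} (n : ℕ) (c d : Ctx m) (X J : RTree m) :
    LpMk m n (.of (d.fill (.node X (c.fill (.node J J))))) = 0 := by
  induction c generalizing d X with
  | hole => exact LpMk_fill_node_square n d X J
  | nodeL c r ih =>
    have h := ih (d.comp (.nodeR X .hole)) r
    rw [Ctx.fill_comp] at h
    have h' := LpMk_fill_antisymm n (d.comp (.nodeR X .hole)) (c.fill (.node J J)) r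
    rw [Ctx.fill_comp, Ctx.fill_comp] at h'
    exact h'.trans (neg_eq_zero.2 h)
  | nodeR l c ih =>
    have h := ih (d.comp (.nodeR X .hole)) l
    rwa [Ctx.fill_comp] at h

theorem brFree_of_of {m : ℕ} (a b : ℕ) (s t : RTree m) :
    brFree m a b (.of s) (.of t) =
      if s.deg = a ∧ t.deg = b then .of (.node s t) else 0 := by
  simp [brFree]

theorem LpMk_brFree_antisymm {m : ℕ} (n a b : ℕ) (x y : FreeAbelianGroup (RTree m)) :
    LpMk m n (brFree m a b x y) = -LpMk m n (brFree m b a y x) := by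
  induction x using FreeAbelianGroup.induction_on with
  | zero => simp
  | of s =>
    induction y using FreeAbelianGroup.induction_on with
    | zero => simp
    | of t =>
      simp only [brFree_of_of, and_comm (a := t.deg = b)]
      split_ifs
      · exact LpMk_fill_antisymm n .hole s t
      · simp
    | neg t h => simp only [map_neg, AddMonoidHom.neg_apply, h]
    | add y z hy hz => simp only [map_add, AddMonoidHom.add_apply, hy, hz]; abel
  | neg s h => simp only [map_neg, AddMonoidHom.neg_apply, h]
  | add x z hx hz => simp only [map_add, AddMonoidHom.add_apply, hx, hz]; abel

theorem LpMk_brFree_jacobi {m : ℕ} (n a b c : ℕ) (x y z : FreeAbelianGroup (RTree m)) :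
    LpMk m n (brFree m a (b + c) x (brFree m b c y z)) =
      LpMk m n (brFree m (a + b) c (brFree m a b x y) z) +
        LpMk m n (brFree m b (a + c) y (brFree m a c x z)) := by
  induction x using FreeAbelianGroup.induction_on with
  | zero => simp
  | of s =>
    induction y using FreeAbelianGroup.induction_on with
    | zero => simp
    | of t =>
      induction z using FreeAbelianGroup.induction_on with
      | zero => simp
      | of u =>
        by_cases hs : s.deg = a <;> by_cases ht : t.deg = b <;> by_cases hu : u.deg = c <;>
          simp only [brFree_of_of, hs, ht, hu, and_self, and_true, and_false,
            if_true, if_false, map_zero, AddMonoidHom.zero_apply, add_zero, RTree.deg]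
        exact LpMk_fill_jacobi n .hole s t u
      | neg u h => simp only [map_neg, h]; abel
      | add u v hu hv => simp only [map_add, hu, hv]; abel
    | neg t h => simp only [map_neg, AddMonoidHom.neg_apply, h]; abel
    | add u v hu hv => simp only [map_add, AddMonoidHom.add_apply, hu, hv]; abel
  | neg s h => simp only [map_neg, AddMonoidHom.neg_apply, h]; abel
  | add u v hu hv => simp only [map_add, AddMonoidHom.add_apply, hu, hv]; abel

theorem LpMk_brFree_square {m : ℕ} (n a b : ℕ) (x y : FreeAbelianGroup (RTree m)) :
    LpMk m n (brFree m a (2 * b) x (brFree m b b y y)) = 0 := by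
  rw [two_mul, LpMk_brFree_jacobi, LpMk_brFree_antisymm n (a + b) b, neg_add_cancel]

theorem LpMk_brFree_eq_zero {m a b : ℕ} {y : FreeAbelianGroup (RTree m)}
    (hy : y ∈ AddSubgroup.closure (quasiLieRels m b)) (x : FreeAbelianGroup (RTree m)) :
    LpMk m (a + b) (brFree m a b x y) = 0 := by
  induction x using FreeAbelianGroup.induction_on with
  | zero => simp
  | neg s h => simpa using h
  | add u v hu hv => simp only [map_add, AddMonoidHom.add_apply, hu, hv, add_zero]
  | of s =>
    induction hy using AddSubgroup.closure_induction with
    | zero => simp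
    | neg u _ h => simpa using h
    | add u v _ _ hu hv => simp only [map_add, hu, hv, add_zero]
    | mem y hy =>
      rcases hy with (⟨J, hJ, rfl⟩ | ⟨c, A, B, rfl⟩) | ⟨c, A, B, C, rfl⟩
      · simp [brFree_of_of, hJ]
      · have h : (c.fill (.node B A)).deg = (c.fill (.node A B)).deg :=
          c.deg_fill_congr (by simp only [RTree.deg]; omega)
        simp only [map_add, brFree_of_of, h]
        split_ifs
        · rw [← eq_neg_iff_add_eq_zero]
          exact LpMk_fill_antisymm _ (.nodeR s c) A B
        · simp
      · have h : (c.fill (.node (.node A B) C)).deg = (c.fill (.node A (.node B C))).deg :=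
          c.deg_fill_congr (by simp only [RTree.deg]; omega)
        have h' : (c.fill (.node B (.node A C))).deg = (c.fill (.node A (.node B C))).deg :=
          c.deg_fill_congr (by simp only [RTree.deg]; omega)
        simp only [map_sub, brFree_of_of, h, h']
        split_ifs
        · rw [sub_sub, sub_eq_zero]
          exact LpMk_fill_jacobi _ (.nodeR s c) A B C
        · simp

/-- The squaring map `y ↦ [y,y]` on representatives, with values in `L'_{2k}`. -/
def sqFree (m k : ℕ) : FreeAbelianGroup (RTree m) →+ Lp m (2 * k) :=
  AddMonoidHom.mk' (fun y => LpMk m (2 * k) (brFree m k k y y)) fun y z => by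
    simp only [map_add, AddMonoidHom.add_apply]
    rw [LpMk_brFree_antisymm _ k k z y]
    abel

theorem sqFree_apply {m k : ℕ} (y : FreeAbelianGroup (RTree m)) :
    sqFree m k y = LpMk m (2 * k) (brFree m k k y y) :=
  rfl

theorem sqFree_eq_zero {m k : ℕ} {y : FreeAbelianGroup (RTree m)}
    (hy : y ∈ AddSubgroup.closure (lieRels m k)) : sqFree m k y = 0 := by
  induction hy using AddSubgroup.closure_induction with
  | zero => simp
  | neg u _ h => simpa using h
  | add u v _ _ hu hv => simp only [map_add, hu, hv, add_zero]
  | mem y hy =>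
    rw [sqFree_apply]
    rcases hy with hy | ⟨c, J, rfl⟩
    · rw [two_mul]
      exact LpMk_brFree_eq_zero (AddSubgroup.subset_closure hy) y
    · rw [brFree_of_of]
      split_ifs
      · exact LpMk_fill_node_fill_square _ c .hole _ J
      · simp

/-- The squaring map `L_k → L'_{2k}`, `Y ↦ [Ŷ,Ŷ]`. -/
def sqLL (m k : ℕ) : LL m k →+ Lp m (2 * k) :=
  QuotientAddGroup.lift _ (sqFree m k) fun _ hy => sqFree_eq_zero hy

theorem sqLL_LLMk {m k : ℕ} (y : FreeAbelianGroup (RTree m)) :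
    sqLL m k (LLMk m k y) = LpMk m (2 * k) (brFree m k k y y) :=
  rfl

theorem two_nsmul_sqLL (m k : ℕ) : 2 • sqLL m k = 0 := by
  refine AddMonoidHom.ext fun y => ?_
  obtain ⟨y, rfl⟩ := QuotientAddGroup.mk'_surjective _ y
  have h := sqLL_LLMk (k := k) y
  have h' := LpMk_brFree_antisymm (2 * k) k k y y
  rw [eq_neg_iff_add_eq_zero] at h'
  rw [AddMonoidHom.nsmul_apply, two_nsmul, AddMonoidHom.zero_apply]
  exact (congrArg₂ (· + ·) h h).trans h'

theorem brLeaf_sqLL {m k : ℕ} (i : Fin m) (y : LL m k) :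
    brLeaf m (2 * k) i (sqLL m k y) = 0 := by
  obtain ⟨y, rfl⟩ := QuotientAddGroup.mk'_surjective _ y
  have h : brLeafFree m i (brFree m k k y y) =
      brFree m 1 (2 * k) (.of (.leaf i)) (brFree m k k y y) := by
    suffices ∀ x z, brLeafFree m i (brFree m k k x z) =
        brFree m 1 (2 * k) (.of (.leaf i)) (brFree m k k x z) from this y y
    intro x z
    induction x using FreeAbelianGroup.induction_on with
    | zero => simp
    | neg s h => simpa using h
    | add u v hu hv => simp only [map_add, AddMonoidHom.add_apply, hu, hv]
    | of s =>
      induction z using FreeAbelianGroup.induction_on with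
      | zero => simp
      | neg s h => simpa using h
      | add u v hu hv => simp only [map_add, hu, hv]
      | of t =>
        rw [brFree_of_of]
        split_ifs with h
        · rw [brFree_of_of, if_pos ⟨rfl, by simp only [RTree.deg]; omega⟩]
          simp [brLeafFree]
        · simp
  have h' := LpMk_brFree_square (2 * k + 1) 1 k (.of (.leaf i)) y
  rw [← h] at h'
  exact h'

theorem bracketLp_of_tmul {m a : ℕ} (i : Fin m) (y : Lp m a) :
    bracketLp m a (.of i ⊗ₜ y) = brLeaf m a i y :=
  (TensorProduct.lift.tmul _ _).trans <|
    congrArg (fun g : Lp m a →ₗ[ℤ] Lp m (a + 1) => g y)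
      (FreeAbelianGroup.lift_apply_of (fun i => (brLeaf m a i).toIntLinearMap) i)

theorem bracketLp_lTensor_sqLL {m k : ℕ} (d : FreeAbelianGroup (Fin m) ⊗[ℤ] Lp m k) :
    bracketLp m (2 * k) (LinearMap.lTensor (FreeAbelianGroup (Fin m))
      ((sqLL m k).comp (LpToLL m k)).toIntLinearMap d) = 0 := by
  induction d using TensorProduct.induction_on with
  | zero => rw [map_zero, map_zero]
  | add u v hu hv => rw [map_add, map_add, hu, hv, add_zero]
  | tmul x y =>
    rw [LinearMap.lTensor_tmul]
    induction x using FreeAbelianGroup.induction_on with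
    | zero => rw [TensorProduct.zero_tmul, map_zero]
    | of i => exact (bracketLp_of_tmul i _).trans (brLeaf_sqLL i _)
    | neg i h => rw [TensorProduct.neg_tmul, map_neg, h, neg_zero]
    | add u v hu hv => rw [TensorProduct.add_tmul, map_add, hu, hv, add_zero]

/-- A homomorphism killed by `2` out of `A` induces one out of `ℤ₂ ⊗ A`. -/
theorem exists_zmod_two_tensor_lift {A B : Type*} [AddCommGroup A] [Module ℤ A] [AddCommGroup B]
    (f : A →+ B) (hf : ∀ a, 2 • f a = 0) :
    ∃ Φ : (ZMod 2) ⊗[ℤ] A →+ B, ∀ a, Φ ((1 : ZMod 2) ⊗ₜ[ℤ] a) = f a := by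
  have hf' : zmultiplesHom (A →+ B) f (2 : ℕ) = 0 := by
    rw [zmultiplesHom_apply, natCast_zsmul]
    exact AddMonoidHom.ext hf
  let g : ZMod 2 →+ A →+ B := ZMod.lift 2 ⟨zmultiplesHom _ f, hf'⟩
  have hg : g 1 = f := by
    simpa [g] using ZMod.lift_coe 2 ⟨zmultiplesHom (A →+ B) f, hf'⟩ 1
  refine ⟨TensorProduct.liftAddHom g fun r z a => ?_, fun a => ?_⟩
  · rw [map_zsmul, AddMonoidHom.zsmul_apply, ← map_zsmul]
    exact congrArg (g z) (int_smul_eq_zsmul _ r a).symm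
  · rw [TensorProduct.liftAddHom_tmul, hg]

/-- In Levine's free quasi-Lie ring, `[X,[Y,Y]] = 0` for all homogeneous
`X ∈ L'_a`, `Y ∈ L'_b` (stated for arbitrary free-abelian-group representatives, via
the degree-guarded free bracket `brFree`).  Consequently, for every `k ≥ 1` the
assignment `X ⊗ Y ↦ X ⊗ [Ŷ,Ŷ]` (for `Y ∈ L_k` with lift `Ŷ ∈ L'_k`) induces a
well-defined homomorphism `ℤ₂ ⊗ D'_{k-1} → D'_{2k-1}`, using the inclusion
`D'_{k-1} ⊆ L'_1 ⊗ L'_k` and the projection `L'_k → L_k` on the second factor;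
the squaring map `σ : L_k → L'_{2k}` is characterized on tree classes. -/
theorem statement19 (m : ℕ) (hm : 1 ≤ m) :
    (∀ a b : ℕ, 1 ≤ a → 1 ≤ b → ∀ x y : FreeAbelianGroup (RTree m),
      LpMk m (a + 2 * b) (brFree m a (2 * b) x (brFree m b b y y)) = 0) ∧
    (∀ k : ℕ, 1 ≤ k →
      ∃ σ : LL m k →+ Lp m (2 * k),
        (∀ T : RTree m, T.deg = k →
          σ (LLMk m k (FreeAbelianGroup.of T)) =
            LpMk m (2 * k) (FreeAbelianGroup.of (RTree.node T T))) ∧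
        ∃ Φ : ((ZMod 2) ⊗[ℤ] ↥(LinearMap.ker (bracketLp m k))) →+
            ↥(LinearMap.ker (bracketLp m (2 * k))),
          ∀ d : ↥(LinearMap.ker (bracketLp m k)),
            ((Φ ((1 : ZMod 2) ⊗ₜ[ℤ] d) :
                ↥(LinearMap.ker (bracketLp m (2 * k)))) :
              (FreeAbelianGroup (Fin m)) ⊗[ℤ] (Lp m (2 * k))) =
              LinearMap.lTensor (FreeAbelianGroup (Fin m))
                ((σ.comp (LpToLL m k)).toIntLinearMap)
                (d : (FreeAbelianGroup (Fin m)) ⊗[ℤ] (Lp m k))) := by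
  refine ⟨fun a b _ _ x y => LpMk_brFree_square _ a b x y, fun k _ => ⟨sqLL m k, ?_, ?_⟩⟩
  · intro T hT
    rw [sqLL_LLMk, brFree_of_of, if_pos ⟨hT, hT⟩]
  · let F := LinearMap.lTensor (FreeAbelianGroup (Fin m))
      ((sqLL m k).comp (LpToLL m k)).toIntLinearMap
    have hF (d) : F d ∈ LinearMap.ker (bracketLp m (2 * k)) := bracketLp_lTensor_sqLL d
    have hF2 (d) : 2 • F d = 0 := by
      induction d using TensorProduct.induction_on with
      | zero => simp
      | add u v hu hv => rw [map_add, nsmul_add, hu, hv, add_zero]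
      | tmul x y =>
        have h := DFunLike.congr_fun (two_nsmul_sqLL m k) (LpToLL m k y)
        rw [AddMonoidHom.nsmul_apply, AddMonoidHom.zero_apply, two_nsmul] at h
        rw [two_nsmul, LinearMap.lTensor_tmul, ← TensorProduct.tmul_add]
        exact (congrArg (x ⊗ₜ[ℤ] ·) h).trans (TensorProduct.tmul_zero _ _)
    obtain ⟨Φ, hΦ⟩ := exists_zmod_two_tensor_lift
      (LinearMap.codRestrict (LinearMap.ker (bracketLp m (2 * k)))
        (F.comp (LinearMap.ker (bracketLp m k)).subtype) fun d => hF d).toAddMonoidHom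
      fun d => Subtype.ext (hF2 d)
    exact ⟨Φ, fun d => congrArg Subtype.val (hΦ d)⟩
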